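/- There exists a constant C > 0, depending only on ω₀, such that Ω(z₁,t) ≤ C for all z₁ ∈ ℝ and all t ≥ 0; consequently Φ(z₁,t) ≤ 2Ct for all z₁ and t. (Thus, in contrast with the true 2D Euler equation, the phase Φ of the hyperbolic 2D Euler equation grows at most linearly in time, which yields only single-exponential growth of the derivatives of the vorticity in the original coordinates.) -/

import Mathlib

open MeasureTheory Real

/-- `IsGlobalSolution ω₀ Φ`: `Φ` is a global solution of the hyperbolic 2D Euler
equation in `z`-coordinates with data `ω₀`: it is continuous on `ℝ × [0,∞)`, bounded
on `ℝ × [0,T]` for every `T > 0`, and with `ω(z₁,z₂,t) := ω₀(z₁, z₂ - Φ(z₁,t))` it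
satisfies `Φ(z₁,t) = (1/2)∫₀ᵗ ∫_{z₁}^∞ ∫_ℝ ω(z̃₁,z₂,s)/cosh(z₂) dz₂ dz̃₁ ds`. -/
def IsGlobalSolution (ω₀ : ℝ × ℝ → ℝ) (Φ : ℝ → ℝ → ℝ) : Prop :=
  ContinuousOn (fun p : ℝ × ℝ => Φ p.1 p.2) (Set.univ ×ˢ Set.Ici (0:ℝ)) ∧
  (∀ T : ℝ, 0 < T → ∃ M, ∀ z₁ : ℝ, ∀ t ∈ Set.Icc (0:ℝ) T, |Φ z₁ t| ≤ M) ∧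
  ∀ (z₁ t : ℝ), 0 ≤ t →
    Φ z₁ t = (1 / 2) * ∫ s in (0:ℝ)..t, ∫ w in Set.Ioi z₁, ∫ z₂ : ℝ,
      ω₀ (w, z₂ - Φ w s) / Real.cosh z₂

/-- The velocity amplitude
`Ω(z₁,t) = (1/4)∫_{z₁}^∞ ∫_ℝ ω₀(z̃₁, z₂ - Φ(z̃₁,t))/cosh(z₂) dz₂ dz̃₁`. -/
noncomputable def Omeg (ω₀ : ℝ × ℝ → ℝ) (Φ : ℝ → ℝ → ℝ) (z₁ t : ℝ) : ℝ :=
  (1 / 4) * ∫ w in Set.Ioi z₁, ∫ z₂ : ℝ, ω₀ (w, z₂ - Φ w t) / Real.cosh z₂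

theorem intervalIntegral.hasDerivAt_integral_of_continuous_deriv {f f' : ℝ → ℝ → ℝ} (a b : ℝ)
    (hf : ∀ t, Continuous (f t)) (hf' : Continuous fun p : ℝ × ℝ => f' p.1 p.2)
    (hderiv : ∀ t w, HasDerivAt (fun s => f s w) (f' t w) t) (t : ℝ) :
    HasDerivAt (fun s => ∫ w in a..b, f s w) (∫ w in a..b, f' t w) t := by
  obtain ⟨M, hM⟩ := ((isCompact_Icc (a := t - 1) (b := t + 1)).prod
    (isCompact_uIcc (a := a) (b := b))).exists_bound_of_continuousOn hf'.continuousOn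
  refine (intervalIntegral.hasDerivAt_integral_of_dominated_loc_of_deriv_le
    (bound := fun _ => M) (Icc_mem_nhds (by linarith) (by linarith))
    (Filter.Eventually.of_forall fun s => (hf s).aestronglyMeasurable)
    ((hf t).intervalIntegrable _ _)
    (by fun_prop : Continuous (f' t)).aestronglyMeasurable
    (Filter.Eventually.of_forall fun w hw s hs => hM (s, w) ⟨hs, Set.uIoc_subset_uIcc hw⟩)
    intervalIntegrable_const
    (Filter.Eventually.of_forall fun w _ s _ => hderiv s w)).2

theorem continuous_intervalIntegral_left {f : ℝ → ℝ → ℝ}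
    (hf : Continuous fun p : ℝ × ℝ => f p.1 p.2) (b : ℝ) :
    Continuous fun p : ℝ × ℝ => ∫ w in p.1..b, f w p.2 := by
  have h : Continuous fun p : ℝ × ℝ => ∫ w in b..p.1, f w p.2 :=
    intervalIntegral.continuous_parametric_intervalIntegral_of_continuous
      (f := fun (p : ℝ × ℝ) w => f w p.2)
      (hf.comp (by fun_prop : Continuous fun x : (ℝ × ℝ) × ℝ => (x.2, x.1.2))) continuous_fst
  simpa only [← intervalIntegral.integral_symm] using h.fun_neg

theorem continuous_intervalIntegral_right {f : ℝ → ℝ → ℝ}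
    (hf : Continuous fun p : ℝ × ℝ => f p.1 p.2) (a : ℝ) :
    Continuous fun p : ℝ × ℝ => ∫ s in a..p.2, f p.1 s :=
  intervalIntegral.continuous_parametric_intervalIntegral_of_continuous
    (f := fun (p : ℝ × ℝ) s => f p.1 s)
    (hf.comp (by fun_prop : Continuous fun x : (ℝ × ℝ) × ℝ => (x.1.1, x.2))) continuous_snd

theorem hasDerivAt_integral_left {f : ℝ → ℝ} (hf : Continuous f) (b z : ℝ) :
    HasDerivAt (fun z => ∫ w in z..b, f w) (-f z) z := by
  simpa only [← intervalIntegral.integral_symm] using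
    (intervalIntegral.integral_hasDerivAt_right (hf.intervalIntegrable b z)
      (hf.stronglyMeasurableAtFilter _ _) hf.continuousAt).fun_neg

theorem hasDerivAt_max_zero_sq (y : ℝ) :
    HasDerivAt (fun y : ℝ => max 0 y ^ 2) (2 * max 0 y) y := by
  rcases lt_trichotomy y 0 with hy | rfl | hy
  · rw [max_eq_left hy.le, mul_zero]
    refine (hasDerivAt_const y (0 : ℝ)).congr_of_eventuallyEq ?_
    filter_upwards [Iio_mem_nhds hy] with x hx
    simp [le_of_lt (Set.mem_Iio.1 hx)]
  · rw [max_self, mul_zero, hasDerivAt_iff_isLittleO_nhds_zero]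
    refine Asymptotics.IsBigO.trans_isLittleO (g := fun h : ℝ => h ^ 2)
      (Asymptotics.IsBigO.of_bound 1 (Filter.Eventually.of_forall fun h => ?_))
      (Asymptotics.isLittleO_pow_id one_lt_two)
    rcases le_total 0 h with hh | hh <;> simp [hh, sq_nonneg]
  · rw [max_eq_right hy.le]
    refine (by simpa using hasDerivAt_pow 2 y : HasDerivAt (fun y : ℝ => y ^ 2) (2 * y) y)
      |>.congr_of_eventuallyEq ?_
    filter_upwards [Ioi_mem_nhds hy] with x hx
    rw [max_eq_right (le_of_lt (Set.mem_Ioi.1 hx))]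

/-- A kernel `q w x` (with `x`-derivative `q'`) that is nonnegative, at most `C * exp x`,
log-Lipschitz in `x`, and decays exponentially in `x` once `x ≥ L`. -/
structure IsDecayingKernel (C L : ℝ) (q q' : ℝ → ℝ → ℝ) : Prop where
  continuous : Continuous fun p : ℝ × ℝ => q p.1 p.2
  continuous_deriv : Continuous fun p : ℝ × ℝ => q' p.1 p.2
  hasDerivAt : ∀ w x, HasDerivAt (q w) (q' w x) x
  nonneg : ∀ w x, 0 ≤ q w x
  le_exp : ∀ w x, q w x ≤ C * exp x
  abs_deriv_le : ∀ w x, |q' w x| ≤ q w x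
  deriv_le : ∀ w x, L ≤ x → q' w x ≤ -(1 / 2) * q w x

/-- The velocity `∫_z^K q(w, w + P(w,t)) dw` generated by the phase `P`. -/
noncomputable def phaseVelocity (K : ℝ) (q P : ℝ → ℝ → ℝ) (z t : ℝ) : ℝ :=
  ∫ w in z..K, q w (w + P w t)

/-- The time integral of the velocity generated by `P`. -/
noncomputable def phaseUpdate (K : ℝ) (q P : ℝ → ℝ → ℝ) (z t : ℝ) : ℝ :=
  ∫ s in (0 : ℝ)..t, phaseVelocity K q P z s

section PhaseFlow

variable {K C L : ℝ} {q q' P : ℝ → ℝ → ℝ}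

theorem continuous_density (hq : IsDecayingKernel C L q q')
    (hP : Continuous fun p : ℝ × ℝ => P p.1 p.2) :
    Continuous fun p : ℝ × ℝ => q p.1 (p.1 + P p.1 p.2) :=
  hq.continuous.comp (by fun_prop : Continuous fun p : ℝ × ℝ => (p.1, p.1 + P p.1 p.2))

theorem continuous_phaseVelocity (hq : IsDecayingKernel C L q q')
    (hP : Continuous fun p : ℝ × ℝ => P p.1 p.2) :
    Continuous fun p : ℝ × ℝ => phaseVelocity K q P p.1 p.2 :=
  continuous_intervalIntegral_left (f := fun w t => q w (w + P w t)) (continuous_density hq hP) K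

theorem continuous_phaseVelocity_right (hq : IsDecayingKernel C L q q')
    (hP : Continuous fun p : ℝ × ℝ => P p.1 p.2) (z : ℝ) :
    Continuous fun t => phaseVelocity K q P z t :=
  (continuous_phaseVelocity hq hP).comp (by fun_prop : Continuous fun t : ℝ => (z, t))

theorem continuous_phaseUpdate (hq : IsDecayingKernel C L q q')
    (hP : Continuous fun p : ℝ × ℝ => P p.1 p.2) :
    Continuous fun p : ℝ × ℝ => phaseUpdate K q P p.1 p.2 :=
  continuous_intervalIntegral_right (continuous_phaseVelocity hq hP) 0

theorem hasDerivAt_phaseVelocity_left (hq : IsDecayingKernel C L q q')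
    (hP : Continuous fun p : ℝ × ℝ => P p.1 p.2) (z t : ℝ) :
    HasDerivAt (fun z => phaseVelocity K q P z t) (-q z (z + P z t)) z :=
  hasDerivAt_integral_left (f := fun w => q w (w + P w t))
    ((continuous_density hq hP).comp (by fun_prop : Continuous fun w : ℝ => (w, t))) K z

theorem antitone_phaseVelocity (hq : IsDecayingKernel C L q q')
    (hP : Continuous fun p : ℝ × ℝ => P p.1 p.2) (t : ℝ) :
    Antitone fun z => phaseVelocity K q P z t :=
  antitone_of_deriv_nonpos
    (fun z => (hasDerivAt_phaseVelocity_left hq hP z t).differentiableAt)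
    fun z => by
      rw [(hasDerivAt_phaseVelocity_left hq hP z t).deriv]
      exact neg_nonpos.2 (hq.nonneg _ _)

theorem phaseVelocity_self (q P : ℝ → ℝ → ℝ) (t : ℝ) : phaseVelocity K q P K t = 0 := by
  simp [phaseVelocity]

theorem phaseVelocity_nonneg (hq : IsDecayingKernel C L q q')
    (hP : Continuous fun p : ℝ × ℝ => P p.1 p.2) {z : ℝ} (hz : z ≤ K) (t : ℝ) :
    0 ≤ phaseVelocity K q P z t := by
  simpa [phaseVelocity_self] using antitone_phaseVelocity (K := K) hq hP t hz

theorem phaseVelocity_nonpos (hq : IsDecayingKernel C L q q')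
    (hP : Continuous fun p : ℝ × ℝ => P p.1 p.2) {z : ℝ} (hz : K ≤ z) (t : ℝ) :
    phaseVelocity K q P z t ≤ 0 := by
  simpa [phaseVelocity_self] using antitone_phaseVelocity (K := K) hq hP t hz

theorem hasDerivAt_phaseUpdate_right (hq : IsDecayingKernel C L q q')
    (hP : Continuous fun p : ℝ × ℝ => P p.1 p.2) (z t : ℝ) :
    HasDerivAt (fun t => phaseUpdate K q P z t) (phaseVelocity K q P z t) t := by
  have h := continuous_phaseVelocity_right (K := K) hq hP z
  exact intervalIntegral.integral_hasDerivAt_right (h.intervalIntegrable 0 t)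
      (h.stronglyMeasurableAtFilter _ _) h.continuousAt

theorem hasDerivAt_phaseUpdate_left (hq : IsDecayingKernel C L q q')
    (hP : Continuous fun p : ℝ × ℝ => P p.1 p.2) (z t : ℝ) :
    HasDerivAt (fun z => phaseUpdate K q P z t)
      (-∫ s in (0 : ℝ)..t, q z (z + P z s)) z := by
  rw [← intervalIntegral.integral_neg]
  refine intervalIntegral.hasDerivAt_integral_of_continuous_deriv
    (f := fun z s => phaseVelocity K q P z s) (f' := fun z s => -q z (z + P z s)) 0 t
    (fun z => continuous_phaseVelocity_right hq hP z) (continuous_density hq hP).neg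
    (fun z s => hasDerivAt_phaseVelocity_left hq hP z s) z

theorem hasDerivAt_phaseVelocity_phaseUpdate (hq : IsDecayingKernel C L q q')
    (hP : Continuous fun p : ℝ × ℝ => P p.1 p.2) (z t : ℝ) :
    HasDerivAt (fun t => phaseVelocity K q (phaseUpdate K q P) z t)
      (∫ w in z..K, q' w (w + phaseUpdate K q P w t) * phaseVelocity K q P w t) t := by
  have hΨ := continuous_phaseUpdate (K := K) hq hP
  have hV := continuous_phaseVelocity (K := K) hq hP
  refine intervalIntegral.hasDerivAt_integral_of_continuous_deriv
    (f := fun t w => q w (w + phaseUpdate K q P w t))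
    (f' := fun t w => q' w (w + phaseUpdate K q P w t) * phaseVelocity K q P w t) z K
    (fun t => ?_) ?_ (fun t w => ?_) t
  · exact (continuous_density hq hΨ).comp (by fun_prop : Continuous fun w : ℝ => (w, t))
  · exact (hq.continuous_deriv.comp (by fun_prop : Continuous fun p : ℝ × ℝ =>
      (p.2, p.2 + phaseUpdate K q P p.2 p.1))).mul (hV.comp continuous_swap)
  · exact (hq.hasDerivAt w _).comp t ((hasDerivAt_phaseUpdate_right hq hP w t).const_add w)

theorem integral_density_mul_phaseVelocity (hq : IsDecayingKernel C L q q')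
    (hP : Continuous fun p : ℝ × ℝ => P p.1 p.2) (a b t : ℝ) :
    ∫ w in a..b, q w (w + P w t) * phaseVelocity K q P w t =
      (phaseVelocity K q P a t ^ 2 - phaseVelocity K q P b t ^ 2) / 2 := by
  have hc : Continuous fun w => q w (w + P w t) * phaseVelocity K q P w t :=
    ((continuous_density hq hP).mul (continuous_phaseVelocity (K := K) hq hP)).comp
      (by fun_prop : Continuous fun w : ℝ => (w, t))
  rw [intervalIntegral.integral_eq_sub_of_hasDerivAt
    (f := fun w => -(phaseVelocity K q P w t ^ 2) / 2) (fun w _ => ?_)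
    (hc.intervalIntegrable _ _)]
  · ring
  · refine (((hasDerivAt_phaseVelocity_left hq hP w t).pow 2).neg.div_const 2).congr_deriv ?_
    simp; ring

theorem phaseVelocity_phaseUpdate
    (hfix : ∀ w t, 0 ≤ t → P w t = phaseUpdate K q P w t) (z : ℝ) {t : ℝ} (ht : 0 ≤ t) :
    phaseVelocity K q (phaseUpdate K q P) z t = phaseVelocity K q P z t := by
  simp only [phaseVelocity, ← hfix _ t ht]

theorem continuous_deriv_mul_phaseVelocity (hq : IsDecayingKernel C L q q')
    (hP : Continuous fun p : ℝ × ℝ => P p.1 p.2) (t : ℝ) :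
    Continuous fun w => q' w (w + P w t) * phaseVelocity K q P w t := by
  have hPt : Continuous fun w => P w t := hP.comp (by fun_prop : Continuous fun w : ℝ => (w, t))
  exact (hq.continuous_deriv.comp (by fun_prop : Continuous fun w : ℝ => (w, w + P w t))).mul
    ((continuous_phaseVelocity hq hP).comp (by fun_prop : Continuous fun w : ℝ => (w, t)))

theorem continuous_density_mul_phaseVelocity (hq : IsDecayingKernel C L q q')
    (hP : Continuous fun p : ℝ × ℝ => P p.1 p.2) (t : ℝ) :
    Continuous fun w => q w (w + P w t) * phaseVelocity K q P w t :=
  ((continuous_density hq hP).mul (continuous_phaseVelocity (K := K) hq hP)).comp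
    (by fun_prop : Continuous fun w : ℝ => (w, t))

theorem integral_deriv_mul_phaseVelocity_le (hq : IsDecayingKernel C L q q')
    (hP : Continuous fun p : ℝ × ℝ => P p.1 p.2) {z : ℝ} (hz : z ≤ K) (t : ℝ) :
    ∫ w in z..K, q' w (w + P w t) * phaseVelocity K q P w t ≤
      phaseVelocity K q P z t ^ 2 / 2 := by
  have h := integral_density_mul_phaseVelocity (K := K) hq hP z K t
  rw [phaseVelocity_self, zero_pow two_ne_zero, sub_zero] at h
  rw [← h]
  refine intervalIntegral.integral_mono_on hz
    ((continuous_deriv_mul_phaseVelocity hq hP t).intervalIntegrable _ _)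
    ((continuous_density_mul_phaseVelocity hq hP t).intervalIntegrable _ _) fun w hw => ?_
  exact mul_le_mul_of_nonneg_right ((le_abs_self _).trans (hq.abs_deriv_le _ _))
    (phaseVelocity_nonneg hq hP hw.2 t)

/-- Since the velocity satisfies the Riccati inequality `V' ≤ V ^ 2 / 2` along a trajectory
`X = z + P z ·`, the quantity `(2 * exp X - V * ∫ exp X) * exp (-X / 2)` is nondecreasing. -/
theorem phaseVelocity_mul_integral_exp_le (hq : IsDecayingKernel C L q q')
    (hP : Continuous fun p : ℝ × ℝ => P p.1 p.2)
    (hfix : ∀ w t, 0 ≤ t → P w t = phaseUpdate K q P w t) {z t : ℝ} (hz : z ≤ K) (ht : 0 ≤ t) :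
    phaseVelocity K q P z t * ∫ s in (0 : ℝ)..t, exp (z + P z s) ≤ 2 * exp (z + P z t) := by
  have hΨ : Continuous fun s => phaseUpdate K q P z s :=
    (continuous_phaseUpdate hq hP).comp (by fun_prop : Continuous fun s : ℝ => (z, s))
  have hexp : Continuous fun s => exp (z + phaseUpdate K q P z s) := by fun_prop
  set G : ℝ → ℝ := fun s =>
    (2 * exp (z + phaseUpdate K q P z s) - phaseVelocity K q (phaseUpdate K q P) z s *
      ∫ r in (0 : ℝ)..s, exp (z + phaseUpdate K q P z r)) *
      exp (-(z + phaseUpdate K q P z s) / 2) with hG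
  have hderiv : ∀ s, 0 ≤ s → HasDerivAt G (exp (-(z + phaseUpdate K q P z s) / 2) *
      (∫ r in (0 : ℝ)..s, exp (z + phaseUpdate K q P z r)) *
      (phaseVelocity K q P z s ^ 2 / 2 -
        ∫ w in z..K, q' w (w + phaseUpdate K q P w s) * phaseVelocity K q P w s)) s := by
    intro s hs
    have hX := (hasDerivAt_phaseUpdate_right (K := K) hq hP z s).const_add z
    have hE := intervalIntegral.integral_hasDerivAt_right (hexp.intervalIntegrable 0 s)
      (hexp.stronglyMeasurableAtFilter _ _) hexp.continuousAt
    have hU := hasDerivAt_phaseVelocity_phaseUpdate (K := K) hq hP z s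
    refine (((hX.exp.const_mul 2).sub (hU.mul hE)).mul ((hX.neg.div_const 2).exp)).congr_deriv ?_
    simp only [Pi.sub_apply, Pi.mul_apply, Pi.neg_apply, phaseVelocity_phaseUpdate hfix z hs]
    ring
  have hmono : MonotoneOn G (Set.Icc 0 t) := by
    refine monotoneOn_of_deriv_nonneg (convex_Icc 0 t)
      (fun s hs => (hderiv s hs.1).continuousAt.continuousWithinAt) ?_ ?_
    · intro s hs
      rw [interior_Icc] at hs
      exact (hderiv s hs.1.le).differentiableAt.differentiableWithinAt
    · intro s hs
      rw [interior_Icc] at hs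
      rw [(hderiv s hs.1.le).deriv]
      have hE : 0 ≤ ∫ r in (0 : ℝ)..s, exp (z + phaseUpdate K q P z r) :=
        intervalIntegral.integral_nonneg hs.1.le fun r _ => (exp_pos _).le
      refine mul_nonneg (mul_nonneg (exp_pos _).le hE) (sub_nonneg.2 ?_)
      simpa only [← hfix _ s hs.1.le] using integral_deriv_mul_phaseVelocity_le hq hP hz s
  have h0 : 0 ≤ G t := by
    refine le_trans ?_ (hmono ⟨le_rfl, ht⟩ ⟨ht, le_rfl⟩ ht)
    simp only [hG, intervalIntegral.integral_same, mul_zero, sub_zero]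
    positivity
  have h1 := nonneg_of_mul_nonneg_left h0 (exp_pos _)
  rw [phaseVelocity_phaseUpdate hfix z ht, ← hfix z t ht, sub_nonneg] at h1
  have hE : ∫ s in (0 : ℝ)..t, exp (z + P z s) =
      ∫ s in (0 : ℝ)..t, exp (z + phaseUpdate K q P z s) := by
    refine intervalIntegral.integral_congr fun s hs => ?_
    rw [Set.uIcc_of_le ht] at hs
    simp only [hfix z s hs.1]
  rwa [hE]

theorem phaseVelocity_mul_integral_density_le (hq : IsDecayingKernel C L q q')
    (hP : Continuous fun p : ℝ × ℝ => P p.1 p.2)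
    (hfix : ∀ w t, 0 ≤ t → P w t = phaseUpdate K q P w t) (hC : 0 ≤ C)
    {z t : ℝ} (hz : z ≤ K) (ht : 0 ≤ t) :
    phaseVelocity K q P z t * ∫ s in (0 : ℝ)..t, q z (z + P z s) ≤
      2 * C * exp (z + P z t) := by
  have hPz : Continuous fun s => P z s := hP.comp (by fun_prop : Continuous fun s : ℝ => (z, s))
  have h : ∫ s in (0 : ℝ)..t, q z (z + P z s) ≤ C * ∫ s in (0 : ℝ)..t, exp (z + P z s) := by
    rw [← intervalIntegral.integral_const_mul]
    refine intervalIntegral.integral_mono_on ht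
      (((continuous_density hq hP).comp
        (by fun_prop : Continuous fun s : ℝ => (z, s))).intervalIntegrable _ _)
      ((by fun_prop : Continuous fun s => C * exp (z + P z s)).intervalIntegrable _ _)
      fun s _ => hq.le_exp _ _
  calc _ ≤ phaseVelocity K q P z t * (C * ∫ s in (0 : ℝ)..t, exp (z + P z s)) :=
        mul_le_mul_of_nonneg_left h (phaseVelocity_nonneg hq hP hz t)
    _ = C * (phaseVelocity K q P z t * ∫ s in (0 : ℝ)..t, exp (z + P z s)) := by ring
    _ ≤ C * (2 * exp (z + P z t)) :=
        mul_le_mul_of_nonneg_left (phaseVelocity_mul_integral_exp_le hq hP hfix hz ht) hC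
    _ = _ := by ring

/-- Where the velocity is at least `4 * C * a` with `a = exp L + 1`, the map `w ↦ w + P w t` has
slope at least `1 / 2` at points where `exp (w + P w t) < a`. Hence such points carry a bounded
amount of density, while at all other points the density decays in time. -/
theorem integral_deriv_mul_phaseVelocity_le_sub (hq : IsDecayingKernel C L q q')
    (hP : Continuous fun p : ℝ × ℝ => P p.1 p.2)
    (hfix : ∀ w t, 0 ≤ t → P w t = phaseUpdate K q P w t) (hC : 0 < C)
    {z y t : ℝ} (hzy : z ≤ y) (hy : y ≤ K) (ht : 0 ≤ t)
    (hV : phaseVelocity K q P y t = 4 * C * (exp L + 1)) :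
    ∫ w in z..y, q' w (w + P w t) * phaseVelocity K q P w t ≤
      -(1 / 2) * ((phaseVelocity K q P z t ^ 2 - phaseVelocity K q P y t ^ 2) / 2) +
        2 * C * (exp L + 1) ^ 2 * phaseVelocity K q P z t := by
  set a := exp L + 1 with ha
  have ha0 : 0 < a := by positivity
  set A := phaseVelocity K q P z t with hA
  have hΨw : ∀ w, HasDerivAt (fun w => P w t) (-∫ s in (0 : ℝ)..t, q w (w + P w s)) w := by
    intro w
    simpa only [← hfix _ t ht] using hasDerivAt_phaseUpdate_left (K := K) hq hP w t
  have hPt : Continuous fun w => P w t := hP.comp (by fun_prop : Continuous fun w : ℝ => (w, t))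
  have hHc : Continuous fun w => ∫ s in (0 : ℝ)..t, q w (w + P w s) :=
    (continuous_intervalIntegral_right (f := fun w s => q w (w + P w s))
      (continuous_density hq hP) 0).comp (by fun_prop : Continuous fun w : ℝ => (w, t))
  set g : ℝ → ℝ := fun w => max 0 (a - exp (w + P w t)) * exp (w + P w t) *
    (1 - ∫ s in (0 : ℝ)..t, q w (w + P w s)) with hg
  have hgc : Continuous g := by fun_prop
  have hgint : ∫ w in z..y, g w ≤ a ^ 2 / 2 := by
    rw [intervalIntegral.integral_eq_sub_of_hasDerivAt
      (f := fun w => -(max 0 (a - exp (w + P w t)) ^ 2 / 2)) (fun w _ => ?_)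
      (hgc.intervalIntegrable _ _)]
    · have h1 : max 0 (a - exp (z + P z t)) ≤ a :=
        max_le ha0.le (by linarith [exp_pos (z + P z t)])
      have h2 : 0 ≤ max 0 (a - exp (z + P z t)) := le_max_left _ _
      nlinarith [sq_nonneg (max 0 (a - exp (y + P y t)))]
    · have hX := (((hasDerivAt_id w).add (hΨw w)).exp).const_sub a
      refine ((((hasDerivAt_max_zero_sq _).comp w hX).div_const 2).neg).congr_deriv ?_
      simp only [hg, Pi.add_apply, id]
      ring
  have hbound : ∀ w ∈ Set.Icc z y, q' w (w + P w t) * phaseVelocity K q P w t ≤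
      -(1 / 2) * (q w (w + P w t) * phaseVelocity K q P w t) + 4 * C * A * g w := by
    intro w hw
    have hVw : 4 * C * a ≤ phaseVelocity K q P w t :=
      hV.ge.trans (antitone_phaseVelocity hq hP t hw.2)
    have hVA : phaseVelocity K q P w t ≤ A := antitone_phaseVelocity hq hP t hw.1
    have hv0 : 0 < 4 * C * a := by positivity
    have hH := phaseVelocity_mul_integral_density_le hq hP hfix hC.le (hw.2.trans hy) ht
    have hH0 : 0 ≤ ∫ s in (0 : ℝ)..t, q w (w + P w s) :=
      intervalIntegral.integral_nonneg ht fun s _ => hq.nonneg _ _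
    have hgw : max 0 (a - exp (w + P w t)) * exp (w + P w t) / 2 ≤ g w := by
      rcases le_total a (exp (w + P w t)) with h | h
      · simp [hg, max_eq_left (sub_nonpos.2 h)]
      · have hH2 : ∫ s in (0 : ℝ)..t, q w (w + P w s) ≤ 1 / 2 := by
          refine le_of_mul_le_mul_left (a := 4 * C * a) ?_ hv0
          calc _ ≤ phaseVelocity K q P w t * ∫ s in (0 : ℝ)..t, q w (w + P w s) :=
                mul_le_mul_of_nonneg_right hVw hH0
            _ ≤ 2 * C * exp (w + P w t) := hH
            _ ≤ 2 * C * a := by gcongr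
            _ = _ := by ring
        have hnn : 0 ≤ max 0 (a - exp (w + P w t)) * exp (w + P w t) := by positivity
        simp only [hg]
        nlinarith
    have hVpos : 0 < phaseVelocity K q P w t := hv0.trans_le hVw
    have hA0 : 0 < A := hVpos.trans_le hVA
    have hκ : 0 ≤ max 0 (a - exp (w + P w t)) * exp (w + P w t) / 2 := by positivity
    rcases le_total L (w + P w t) with h | h
    · have h1 := mul_le_mul_of_nonneg_right (hq.deriv_le w _ h) hVpos.le
      have h2 : 0 ≤ 4 * C * A * g w := mul_nonneg (by positivity) (hκ.trans hgw)
      linarith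
    · have h1 : 1 ≤ max 0 (a - exp (w + P w t)) :=
        le_max_of_le_right (by linarith [exp_le_exp.2 h])
      have h2 : exp (w + P w t) ≤ 2 * g w := by
        nlinarith [exp_pos (w + P w t)]
      have h3 : q' w (w + P w t) ≤ q w (w + P w t) :=
        (le_abs_self _).trans (hq.abs_deriv_le _ _)
      have h4 : q w (w + P w t) ≤ C * (2 * g w) :=
        (hq.le_exp _ _).trans (mul_le_mul_of_nonneg_left h2 hC.le)
      have h5 : q w (w + P w t) * phaseVelocity K q P w t ≤ C * (2 * g w) * A :=
        mul_le_mul h4 hVA hVpos.le ((hq.nonneg _ _).trans h4)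
      have h6 := mul_le_mul_of_nonneg_right h3 hVpos.le
      have h7 := mul_nonneg (hq.nonneg w (w + P w t)) hVpos.le
      nlinarith
  have hc1 : Continuous fun w => -(1 / 2) * (q w (w + P w t) * phaseVelocity K q P w t) :=
    (continuous_density_mul_phaseVelocity (K := K) hq hP t).const_mul _
  calc _ ≤ ∫ w in z..y, (-(1 / 2) * (q w (w + P w t) * phaseVelocity K q P w t) +
        4 * C * A * g w) :=
        intervalIntegral.integral_mono_on hzy
          ((continuous_deriv_mul_phaseVelocity hq hP t).intervalIntegrable _ _)
          ((hc1.add (hgc.const_mul _)).intervalIntegrable _ _) hbound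
    _ = -(1 / 2) * ((A ^ 2 - phaseVelocity K q P y t ^ 2) / 2) +
          4 * C * A * ∫ w in z..y, g w := by
        rw [intervalIntegral.integral_add (hc1.intervalIntegrable _ _)
          ((hgc.const_mul _).intervalIntegrable _ _), intervalIntegral.integral_const_mul,
          intervalIntegral.integral_const_mul, integral_density_mul_phaseVelocity hq hP]
    _ ≤ _ := by
        have hA0 : 0 ≤ 4 * C * A :=
          mul_nonneg (by positivity) (phaseVelocity_nonneg hq hP (hzy.trans hy) t)
        nlinarith [mul_le_mul_of_nonneg_left hgint hA0]

theorem phaseVelocity_zero_le (hq : IsDecayingKernel C L q q')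
    (hP : Continuous fun p : ℝ × ℝ => P p.1 p.2) (hP0 : ∀ w, P w 0 = 0) (hC : 0 ≤ C) (z : ℝ) :
    phaseVelocity K q P z 0 ≤ C * exp K := by
  rcases le_total z K with hz | hz
  · calc phaseVelocity K q P z 0 ≤ ∫ w in z..K, C * exp w := by
          refine intervalIntegral.integral_mono_on hz
            (((continuous_density hq hP).comp
              (by fun_prop : Continuous fun w : ℝ => (w, (0 : ℝ)))).intervalIntegrable _ _)
            ((by fun_prop : Continuous fun w => C * exp w).intervalIntegrable _ _) fun w _ => ?_
          simpa [hP0] using hq.le_exp w w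
      _ = C * (exp K - exp z) := by rw [intervalIntegral.integral_const_mul, integral_exp]
      _ ≤ _ := mul_le_mul_of_nonneg_left (by linarith [exp_pos z]) hC
  · exact (phaseVelocity_nonpos hq hP hz 0).trans (by positivity)

/-- The velocity of a fixed point `P` of `phaseUpdate` is bounded uniformly in space and time. -/
theorem phaseVelocity_le (hq : IsDecayingKernel C L q q')
    (hP : Continuous fun p : ℝ × ℝ => P p.1 p.2)
    (hfix : ∀ w t, 0 ≤ t → P w t = phaseUpdate K q P w t) (hC : 0 < C)
    {z t : ℝ} (ht : 0 ≤ t) :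
    phaseVelocity K q P z t ≤
      8 * C * (exp L + 1) ^ 2 + 2 * (4 * C * (exp L + 1)) + 1 + C * exp K := by
  set v := 4 * C * (exp L + 1) with hv
  have hv0 : 0 < v := by positivity
  set D := 2 * C * (exp L + 1) ^ 2 with hD
  have hD0 : 0 < D := by positivity
  rw [show 8 * C * (exp L + 1) ^ 2 = 4 * D by rw [hD]; ring]
  have hE0 : 0 ≤ C * exp K := by positivity
  set A := 4 * D + 2 * v + 1 + C * exp K with hA
  have hderiv := hasDerivAt_phaseVelocity_phaseUpdate (K := K) hq hP z
  rw [← phaseVelocity_phaseUpdate hfix z ht]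
  refine image_le_of_deriv_right_lt_deriv_boundary' (a := 0) (b := t) (B := fun _ => A)
    (B' := fun _ => 0) (fun s _ => (hderiv s).continuousAt.continuousWithinAt)
    (fun s _ => (hderiv s).hasDerivWithinAt) ?_ continuousOn_const
    (fun s _ => hasDerivWithinAt_const _ _ _) ?_ ⟨ht, le_rfl⟩
  · rw [phaseVelocity_phaseUpdate hfix z le_rfl]
    have h0 : ∀ w, P w 0 = 0 := fun w => by simp [hfix w 0 le_rfl, phaseUpdate]
    linarith [phaseVelocity_zero_le (K := K) hq hP h0 hC.le z]
  · intro s hs hsA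
    rw [phaseVelocity_phaseUpdate hfix z hs.1] at hsA
    simp only [← hfix _ s hs.1]
    have hzK : z ≤ K := by
      by_contra! h
      linarith [phaseVelocity_nonpos (K := K) hq hP h.le s]
    obtain ⟨y, hy, hyv⟩ := intermediate_value_Icc' hzK
      (f := fun z => phaseVelocity K q P z s)
      (fun w _ => (hasDerivAt_phaseVelocity_left hq hP w s).continuousAt.continuousWithinAt)
      (show v ∈ Set.Icc _ _ by
        simp only [phaseVelocity_self, hsA]; exact ⟨hv0.le, by linarith⟩)
    have h1 := integral_deriv_mul_phaseVelocity_le_sub hq hP hfix hC hy.1 hy.2 hs.1 hyv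
    have h2 := integral_deriv_mul_phaseVelocity_le hq hP hy.2 s
    have hc := continuous_deriv_mul_phaseVelocity (K := K) hq hP s
    rw [← intervalIntegral.integral_add_adjacent_intervals (hc.intervalIntegrable z y)
      (hc.intervalIntegrable y K)]
    simp only at hyv
    rw [hsA, hyv, ← hD] at h1
    rw [hyv] at h2
    have hAv : 2 * v ≤ A := by linarith
    have hA1 : 4 * D + 2 * v + 1 ≤ A := by linarith
    nlinarith [mul_le_mul_of_nonneg_right hA1 (by linarith : 0 ≤ A)]

end PhaseFlow

theorem Real.cosh_le_two_mul_sinh {y : ℝ} (hy : 1 ≤ y) : cosh y ≤ 2 * sinh y := by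
  have h1 : exp (-y) * exp y = 1 := by rw [← exp_add]; simp
  have h2 : 2 ≤ exp y := by linarith [add_one_le_exp y]
  rw [cosh_eq, sinh_eq]
  nlinarith [exp_pos (-y)]

theorem Real.inv_cosh_le_two_mul_exp (y : ℝ) : (cosh y)⁻¹ ≤ 2 * exp y := by
  rw [inv_le_iff_one_le_mul₀ (cosh_pos y), cosh_eq]
  have h1 : exp y * exp (-y) = 1 := by rw [← exp_add]; simp
  nlinarith [exp_pos y, exp_pos (-y)]

/-- The strip integral `(1/2) ∫_{-K}^K ω₀(w, w + ξ) / cosh(ξ + x) dξ`. -/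
noncomputable def stripKernel (K : ℝ) (ω₀ : ℝ × ℝ → ℝ) (w x : ℝ) : ℝ :=
  1 / 2 * ∫ ξ in (-K)..K, ω₀ (w, w + ξ) / cosh (ξ + x)

/-- The derivative of `stripKernel` in its last argument. -/
noncomputable def stripKernelDeriv (K : ℝ) (ω₀ : ℝ × ℝ → ℝ) (w x : ℝ) : ℝ :=
  1 / 2 * ∫ ξ in (-K)..K, -(ω₀ (w, w + ξ) * sinh (ξ + x) / cosh (ξ + x) ^ 2)

theorem isDecayingKernel_stripKernel {K M : ℝ} (hK : 0 < K) {ω₀ : ℝ × ℝ → ℝ}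
    (hω : Continuous ω₀) (hM : ∀ z, ω₀ z ≤ M) (hpos : ∀ z, 0 ≤ ω₀ z) :
    IsDecayingKernel (2 * K * M * exp K) (K + 1) (stripKernel K ω₀) (stripKernelDeriv K ω₀) := by
  have hc : Continuous fun p : (ℝ × ℝ) × ℝ => ω₀ (p.1.1, p.1.1 + p.2) / cosh (p.2 + p.1.2) :=
    (hω.comp (by fun_prop : Continuous fun p : (ℝ × ℝ) × ℝ => (p.1.1, p.1.1 + p.2))).div
      (continuous_cosh.comp (by fun_prop)) fun p => (cosh_pos _).ne'
  have hc' : Continuous fun p : (ℝ × ℝ) × ℝ =>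
      -(ω₀ (p.1.1, p.1.1 + p.2) * sinh (p.2 + p.1.2) / cosh (p.2 + p.1.2) ^ 2) :=
    (((hω.comp (by fun_prop : Continuous fun p : (ℝ × ℝ) × ℝ => (p.1.1, p.1.1 + p.2))).mul
      (continuous_sinh.comp (by fun_prop : Continuous fun p : (ℝ × ℝ) × ℝ => p.2 + p.1.2))).div
      ((continuous_cosh.comp
        (by fun_prop : Continuous fun p : (ℝ × ℝ) × ℝ => p.2 + p.1.2)).pow 2)
      fun p => (pow_pos (cosh_pos _) 2).ne').neg
  have hi : ∀ w x, IntervalIntegrable (fun ξ => ω₀ (w, w + ξ) / cosh (ξ + x)) volume (-K) K :=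
    fun w x => (hc.comp (by fun_prop : Continuous fun ξ : ℝ => ((w, x), ξ))).intervalIntegrable _ _
  have hi' : ∀ w x, IntervalIntegrable
      (fun ξ => -(ω₀ (w, w + ξ) * sinh (ξ + x) / cosh (ξ + x) ^ 2)) volume (-K) K :=
    fun w x => (hc'.comp (by fun_prop : Continuous fun ξ : ℝ => ((w, x), ξ))).intervalIntegrable _ _
  have hKK : -K ≤ K := by linarith
  have hfrac : ∀ u y : ℝ, u * sinh y / cosh y ^ 2 = u / cosh y * (sinh y / cosh y) := by
    intro u y
    have := (cosh_pos y).ne'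
    field_simp
  refine ⟨?_, ?_, ?_, ?_, ?_, ?_, ?_⟩
  · exact continuous_const.mul
      (intervalIntegral.continuous_parametric_intervalIntegral_of_continuous'
        (f := fun (p : ℝ × ℝ) ξ => ω₀ (p.1, p.1 + ξ) / cosh (ξ + p.2)) hc (-K) K)
  · exact continuous_const.mul
      (intervalIntegral.continuous_parametric_intervalIntegral_of_continuous'
        (f := fun (p : ℝ × ℝ) ξ => -(ω₀ (p.1, p.1 + ξ) * sinh (ξ + p.2) / cosh (ξ + p.2) ^ 2))
        hc' (-K) K)
  · intro w x
    refine (intervalIntegral.hasDerivAt_integral_of_continuous_deriv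
      (f := fun x ξ => ω₀ (w, w + ξ) / cosh (ξ + x))
      (f' := fun x ξ => -(ω₀ (w, w + ξ) * sinh (ξ + x) / cosh (ξ + x) ^ 2)) (-K) K
      (fun x => hc.comp (by fun_prop : Continuous fun ξ : ℝ => ((w, x), ξ)))
      (hc'.comp (by fun_prop : Continuous fun p : ℝ × ℝ => ((w, p.1), p.2)))
      (fun x ξ => ?_) x).const_mul (1 / 2)
    refine ((hasDerivAt_const x (ω₀ (w, w + ξ))).div ((hasDerivAt_id x).const_add ξ).cosh
      (cosh_pos _).ne').congr_deriv ?_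
    simp only [id]
    ring
  · intro w x
    exact mul_nonneg (by norm_num) (intervalIntegral.integral_nonneg hKK fun ξ _ =>
      div_nonneg (hpos _) (cosh_pos _).le)
  · intro w x
    have h : ∫ ξ in (-K)..K, ω₀ (w, w + ξ) / cosh (ξ + x) ≤
        ∫ _ in (-K)..K, M * (2 * (exp K * exp x)) := by
      refine intervalIntegral.integral_mono_on hKK (hi w x) intervalIntegrable_const fun ξ hξ => ?_
      rw [div_eq_mul_inv]
      refine mul_le_mul (hM _) ((inv_cosh_le_two_mul_exp _).trans ?_)
        (inv_nonneg.2 (cosh_pos _).le) ((hpos 0).trans (hM 0))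
      rw [← exp_add]
      gcongr
      exact hξ.2
    rw [intervalIntegral.integral_const, smul_eq_mul] at h
    rw [stripKernel]
    linarith
  · intro w x
    rw [stripKernelDeriv, stripKernel, abs_mul, abs_of_pos (by norm_num : (0 : ℝ) < 1 / 2)]
    refine mul_le_mul_of_nonneg_left
      ((intervalIntegral.abs_integral_le_integral_abs hKK).trans ?_) (by norm_num)
    refine intervalIntegral.integral_mono_on hKK (hi' w x).abs (hi w x) fun ξ _ => ?_
    have h0 : 0 ≤ ω₀ (w, w + ξ) / cosh (ξ + x) := div_nonneg (hpos _) (cosh_pos _).le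
    rw [abs_neg, hfrac, abs_mul, abs_of_nonneg h0]
    refine mul_le_of_le_one_right h0 ?_
    rw [abs_div, abs_of_pos (cosh_pos _), div_le_one (cosh_pos _), abs_le]
    constructor <;> rw [cosh_eq, sinh_eq] <;> linarith [exp_pos (ξ + x), exp_pos (-(ξ + x))]
  · intro w x hx
    have h : ∫ ξ in (-K)..K, -(ω₀ (w, w + ξ) * sinh (ξ + x) / cosh (ξ + x) ^ 2) ≤
        ∫ ξ in (-K)..K, -(1 / 2) * (ω₀ (w, w + ξ) / cosh (ξ + x)) := by
      refine intervalIntegral.integral_mono_on hKK (hi' w x) ((hi w x).const_mul _) fun ξ hξ => ?_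
      have h0 : 0 ≤ ω₀ (w, w + ξ) / cosh (ξ + x) := div_nonneg (hpos _) (cosh_pos _).le
      have h1 : 1 / 2 ≤ sinh (ξ + x) / cosh (ξ + x) := by
        rw [le_div_iff₀ (cosh_pos _)]
        linarith [cosh_le_two_mul_sinh (y := ξ + x) (by linarith [hξ.1])]
      rw [hfrac]
      nlinarith
    rw [intervalIntegral.integral_const_mul] at h
    rw [stripKernelDeriv, stripKernel]
    linarith

theorem integral_shift_div_cosh_eq_stripKernel {K : ℝ} (hK : 0 < K) {ω₀ : ℝ × ℝ → ℝ}
    (hsupp : ∀ z : ℝ × ℝ, ω₀ z ≠ 0 → |z.1 - z.2| ≤ K ∧ z.1 + z.2 ≤ K) (w φ : ℝ) :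
    ∫ y : ℝ, ω₀ (w, y - φ) / cosh y = 2 * stripKernel K ω₀ w (w + φ) := by
  rw [← integral_add_right_eq_self _ (w + φ), stripKernel, ← mul_assoc,
    intervalIntegral.integral_of_le (by linarith), ← integral_Icc_eq_integral_Ioc,
    setIntegral_eq_integral_of_forall_compl_eq_zero]
  · norm_num
    refine integral_congr_ae (Filter.Eventually.of_forall fun ξ => ?_)
    simp only
    congr 3
    ring
  · intro ξ hξ
    by_contra h
    have h1 := (hsupp (w, w + ξ) fun h0 => h (by simp [h0])).1
    simp only [sub_add_cancel_left, abs_neg] at h1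
    exact hξ (abs_le.1 h1)

theorem stripKernel_eq_zero {K : ℝ} {ω₀ : ℝ × ℝ → ℝ}
    (hsupp : ∀ z : ℝ × ℝ, ω₀ z ≠ 0 → |z.1 - z.2| ≤ K ∧ z.1 + z.2 ≤ K) {w : ℝ} (hw : K < w)
    (x : ℝ) : stripKernel K ω₀ w x = 0 := by
  have h : ∀ ξ, ω₀ (w, w + ξ) = 0 := by
    intro ξ
    by_contra h
    obtain ⟨h1, h2⟩ := hsupp _ h
    simp only at h1 h2
    linarith [(abs_le.1 h1).2]
  simp [stripKernel, h]

theorem setIntegral_Ioi_eq_intervalIntegral {f : ℝ → ℝ} {K : ℝ} (hf : ∀ w, K < w → f w = 0)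
    (z : ℝ) : ∫ w in Set.Ioi z, f w = ∫ w in z..K, f w := by
  rcases le_total z K with hz | hz
  · rw [intervalIntegral.integral_of_le hz]
    refine setIntegral_eq_of_subset_of_forall_sdiff_eq_zero measurableSet_Ioi
      Set.Ioc_subset_Ioi_self fun w hw => hf w ?_
    by_contra! h
    exact hw.2 ⟨hw.1, h⟩
  · rw [intervalIntegral.integral_of_ge hz,
      setIntegral_eq_zero_of_forall_eq_zero (t := Set.Ioi z)
        fun w hw => hf w (lt_of_le_of_lt hz hw),
      setIntegral_eq_zero_of_forall_eq_zero (t := Set.Ioc K z) fun w hw => hf w hw.1, neg_zero]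

theorem integral_Ioi_integral_div_cosh {K : ℝ} (hK : 0 < K) {ω₀ : ℝ × ℝ → ℝ}
    (hsupp : ∀ z : ℝ × ℝ, ω₀ z ≠ 0 → |z.1 - z.2| ≤ K ∧ z.1 + z.2 ≤ K) (Φ : ℝ → ℝ → ℝ)
    (z t : ℝ) :
    ∫ w in Set.Ioi z, ∫ y : ℝ, ω₀ (w, y - Φ w t) / cosh y =
      2 * phaseVelocity K (stripKernel K ω₀) Φ z t := by
  simp only [integral_shift_div_cosh_eq_stripKernel hK hsupp]
  rw [integral_const_mul, setIntegral_Ioi_eq_intervalIntegral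
    (fun w hw => stripKernel_eq_zero hsupp hw _), phaseVelocity]

/-- Main regularity result for hyperbolic 2D Euler: the velocity amplitude `Ω` is
uniformly bounded in time by a constant depending only on `ω₀`, and hence the phase
grows at most linearly: `Φ(z₁,t) ≤ 2Ct`. -/
theorem stmt_8 (K : ℝ) (hK : 0 < K) (ω₀ : ℝ × ℝ → ℝ)
    (hC1 : ContDiff ℝ 1 ω₀) (hbdd : ∃ M, ∀ z, |ω₀ z| ≤ M)
    (hpos : ∀ z, 0 ≤ ω₀ z)
    (hsupp : ∀ z : ℝ × ℝ, ω₀ z ≠ 0 → |z.1 - z.2| ≤ K ∧ z.1 + z.2 ≤ K) :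
    ∃ C : ℝ, 0 < C ∧
      ∀ Φ : ℝ → ℝ → ℝ, IsGlobalSolution ω₀ Φ →
        ∀ (z₁ t : ℝ), 0 ≤ t →
          Omeg ω₀ Φ z₁ t ≤ C ∧ Φ z₁ t ≤ 2 * C * t := by
  obtain ⟨M, hM⟩ := hbdd
  have hq := isDecayingKernel_stripKernel (M := max M 1) hK hC1.continuous
    (fun z => ((le_abs_self _).trans (hM z)).trans (le_max_left _ _)) hpos
  set C := 2 * K * max M 1 * exp K with hC
  have hC0 : 0 < C := by positivity
  set A := 8 * C * (exp (K + 1) + 1) ^ 2 + 2 * (4 * C * (exp (K + 1) + 1)) + 1 + C * exp K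
    with hA
  refine ⟨A / 2, by positivity, fun Φ ⟨hcont, _, hΦ⟩ z₁ t ht => ?_⟩
  set P : ℝ → ℝ → ℝ := fun w t => Φ w (max t 0) with hPdef
  have hPΦ : ∀ w t, 0 ≤ t → P w t = Φ w t := fun w t ht => by simp [hPdef, ht]
  have hP : Continuous fun p : ℝ × ℝ => P p.1 p.2 :=
    hcont.comp_continuous (by fun_prop : Continuous fun p : ℝ × ℝ => (p.1, max p.2 0))
      fun p => ⟨Set.mem_univ _, Set.mem_Ici.2 (le_max_right _ _)⟩
  have hV : ∀ z t, 0 ≤ t → phaseVelocity K (stripKernel K ω₀) Φ z t =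
      phaseVelocity K (stripKernel K ω₀) P z t := fun z t ht => by
    simp only [phaseVelocity, hPΦ _ t ht]
  have hΦP : ∀ w t, 0 ≤ t → Φ w t = phaseUpdate K (stripKernel K ω₀) P w t := by
    intro w t ht
    rw [hΦ w t ht, phaseUpdate]
    simp only [integral_Ioi_integral_div_cosh hK hsupp]
    rw [intervalIntegral.integral_const_mul, ← mul_assoc, one_div_mul_cancel two_ne_zero, one_mul]
    refine intervalIntegral.integral_congr fun s hs => ?_
    rw [Set.uIcc_of_le ht] at hs
    exact hV w s hs.1
  have hbound : ∀ z t, 0 ≤ t → phaseVelocity K (stripKernel K ω₀) P z t ≤ A := fun z t ht =>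
    phaseVelocity_le hq hP (fun w t ht => (hPΦ w t ht).trans (hΦP w t ht)) hC0 ht
  constructor
  · rw [Omeg, integral_Ioi_integral_div_cosh hK hsupp, hV z₁ t ht]
    linarith [hbound z₁ t ht]
  · rw [hΦP z₁ t ht, phaseUpdate]
    have hc := continuous_phaseVelocity_right (K := K) hq hP z₁
    have h := intervalIntegral.integral_mono_on ht (hc.intervalIntegrable _ _)
      (intervalIntegrable_const (μ := volume) (c := A)) fun s hs => hbound z₁ s hs.1
    rw [intervalIntegral.integral_const, smul_eq_mul] at h
    linarith
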